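/- arXiv:2010.15658 — 2 statements merged into one kernel-verified Lean document; each statement's English description precedes it below -/
import Mathlib

section
/- Let A ∈ ℝ^{n×N}, τ, λ > 0, and suppose the samples x_1, …, x_m ∈ ℝ^N are drawn i.i.d. according to a probability distribution D such that ‖x_i‖₂ ≤ B_in almost surely, and set B_out = B_in. Let y_i = A x_i and assume τ‖A‖²_{2→2} ≤ 1. Then for every δ ∈ (0,1), with probability at least 1 − δ over the draw of the samples, for all h in the hypothesis class H_1^L, the true risk L(h) = E_{x∼D} ‖h(Ax) − x‖₂ satisfies L(h) ≤ L̂(h) + 8 B_out √(Nn·log(2 + 8L(L+3))/m) + 8 B_out N √(log(e + 8eL))/√m + B_out √(128 log(4/δ)/m), where L̂(h) = (1/m) Σ_{i=1}^m ‖h(y_i) − x_i‖₂ is the empirical risk. -/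
open MeasureTheory Matrix
open scoped ENNReal

noncomputable def soft (mu x : ℝ) : ℝ := Real.sign x * max 0 (|x| - mu)

noncomputable def softMat {a b : ℕ} (mu : ℝ) (M : Matrix (Fin a) (Fin b) ℝ) :
    Matrix (Fin a) (Fin b) ℝ := Matrix.of fun i j => soft mu (M i j)

noncomputable def specNorm {a b : ℕ} (A : Matrix (Fin a) (Fin b) ℝ) : ℝ :=
  ‖LinearMap.toContinuousLinearMap (Matrix.toEuclideanLin A)‖

noncomputable def frobNorm {a b : ℕ} (A : Matrix (Fin a) (Fin b) ℝ) : ℝ :=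
  Real.sqrt (∑ i, ∑ j, (A i j) ^ 2)

noncomputable def l2 {N : ℕ} (x : Fin N → ℝ) : ℝ := Real.sqrt (∑ i, x i ^ 2)

noncomputable def sigma {N : ℕ} (B : ℝ) (x : Fin N → ℝ) : Fin N → ℝ :=
  if l2 x ≤ B then x else (B / l2 x) • x

noncomputable def sigmaMat {N m : ℕ} (B : ℝ) (M : Matrix (Fin N) (Fin m) ℝ) :
    Matrix (Fin N) (Fin m) ℝ := Matrix.of fun i j => sigma B (fun k => M k j) i

def IsOrthogonal {N : ℕ} (Φ : Matrix (Fin N) (Fin N) ℝ) : Prop := Φᵀ * Φ = 1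

noncomputable def ista {n N m : ℕ} (A : Matrix (Fin n) (Fin N) ℝ) (τ lam : ℝ)
    (Φ : Matrix (Fin N) (Fin N) ℝ) (Y : Matrix (Fin n) (Fin m) ℝ) :
    ℕ → Matrix (Fin N) (Fin m) ℝ
  | 0 => 0
  | l + 1 => softMat (τ * lam)
      ((1 - τ • (Φᵀ * Aᵀ * A * Φ)) * ista A τ lam Φ Y l + τ • ((A * Φ)ᵀ * Y))

noncomputable def istaVec {n N : ℕ} (A : Matrix (Fin n) (Fin N) ℝ) (τ lam : ℝ)
    (Φ : Matrix (Fin N) (Fin N) ℝ) (y : Fin n → ℝ) : ℕ → Fin N → ℝ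
  | 0 => 0
  | l + 1 => soft (τ * lam) ∘
      ((1 - τ • (Φᵀ * Aᵀ * A * Φ)) *ᵥ istaVec A τ lam Φ y l + τ • ((A * Φ)ᵀ *ᵥ y))

noncomputable def KL {n N m : ℕ} (A : Matrix (Fin n) (Fin N) ℝ) (τ : ℝ)
    (Y : Matrix (Fin n) (Fin m) ℝ) (L : ℕ) : ℝ :=
  τ * frobNorm Y * specNorm (1 - τ • (Aᵀ * A)) ^ (L - 1)
    + τ * frobNorm Y * ∑ l ∈ Finset.Icc 2 L,
        specNorm (1 - τ • (Aᵀ * A)) ^ (L - l) *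
          (1 + 2 * τ * specNorm A ^ 2 *
            ∑ k ∈ Finset.range (l - 1), specNorm (1 - τ • (Aᵀ * A)) ^ k)

noncomputable def ML {n N m : ℕ} (A : Matrix (Fin n) (Fin N) ℝ) (τ : ℝ)
    (Y : Matrix (Fin n) (Fin m) ℝ) (L : ℕ) : ℝ :=
  τ * specNorm A * frobNorm Y * ∑ k ∈ Finset.range L, specNorm (1 - τ • (Aᵀ * A)) ^ k

noncomputable def coveringNumber {α : Type*} (d : α → α → ℝ) (s : Set α) (ε : ℝ) : ℝ≥0∞ :=
  ⨅ (t : Finset α) (_ : ∀ x ∈ s, ∃ y ∈ t, d x y ≤ ε), (t.card : ℝ≥0∞)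


lemma sepCard {E : Type*} [NormedAddCommGroup E] [NormedSpace ℝ E] [FiniteDimensional ℝ E]
    (s : Finset E) (ε : ℝ) (hε : 0 < ε) (hs : ∀ c ∈ s, ‖c‖ ≤ 1)
    (h : ∀ c ∈ s, ∀ d ∈ s, c ≠ d → ε ≤ ‖c - d‖) :
    (s.card : ℝ) ≤ (1 + 2 / ε) ^ Module.finrank ℝ E := by
  borelize E
  let μ : Measure E := Measure.addHaar
  have hδ : 0 < ε / 2 := by positivity
  have ρpos : 0 < 1 + ε / 2 := by positivity
  have D : Set.Pairwise (s : Set E) (Function.onFun Disjoint fun c => Metric.ball (c : E) (ε / 2)) := by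
    rintro c hc d hd hcd
    apply Metric.ball_disjoint_ball
    rw [dist_eq_norm]
    have := h c hc d hd hcd
    linarith
  have A_subset : (⋃ c ∈ s, Metric.ball (c : E) (ε / 2)) ⊆ Metric.ball (0 : E) (1 + ε / 2) := by
    refine Set.iUnion₂_subset fun x hx => ?_
    apply Metric.ball_subset_ball'
    rw [dist_zero_right]
    have := hs x hx
    linarith
  have I : (s.card : ℝ≥0∞) * ENNReal.ofReal ((ε / 2) ^ Module.finrank ℝ E) * μ (Metric.ball 0 1) ≤
      ENNReal.ofReal ((1 + ε / 2) ^ Module.finrank ℝ E) * μ (Metric.ball 0 1) :=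
    calc
      _ = μ (⋃ c ∈ s, Metric.ball (c : E) (ε / 2)) := by
        rw [measure_biUnion_finset D fun c _ => measurableSet_ball]
        simp only [μ.addHaar_ball_of_pos _ hδ]
        simp only [Finset.sum_const, nsmul_eq_mul, mul_assoc]
      _ ≤ μ (Metric.ball (0 : E) (1 + ε / 2)) := measure_mono A_subset
      _ = _ := by
        simp only [μ.addHaar_ball_of_pos _ ρpos]
  have J : (s.card : ℝ≥0∞) * ENNReal.ofReal ((ε / 2) ^ Module.finrank ℝ E)
      ≤ ENNReal.ofReal ((1 + ε / 2) ^ Module.finrank ℝ E) :=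
    (ENNReal.mul_le_mul_iff_left (Metric.measure_ball_pos _ _ zero_lt_one).ne' measure_ball_lt_top.ne).1 I
  have K := ENNReal.toReal_le_of_le_ofReal (pow_nonneg ρpos.le _) J
  rw [ENNReal.toReal_mul, ENNReal.toReal_natCast, ENNReal.toReal_ofReal (by positivity),
    ← le_div_iff₀ (by positivity), ← div_pow] at K
  refine K.trans (le_of_eq ?_)
  congr 1
  field_simp
  ring

lemma exNet {E : Type*} [NormedAddCommGroup E] [NormedSpace ℝ E] [FiniteDimensional ℝ E]
    (s : Set E) (hs : ∀ c ∈ s, ‖c‖ ≤ 1) (ε : ℝ) (hε : 0 < ε) :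
    ∃ T : Finset E, (∀ t ∈ T, t ∈ s) ∧ (∀ x ∈ s, ∃ t ∈ T, ‖x - t‖ ≤ ε) ∧
      (T.card : ℝ) ≤ (1 + 2 / ε) ^ Module.finrank ℝ E := by
  classical
  let P : Set ℕ := {k | ∃ T : Finset E, (∀ t ∈ T, t ∈ s) ∧
    (∀ c ∈ T, ∀ d ∈ T, c ≠ d → ε ≤ ‖c - d‖) ∧ T.card = k}
  have hne : P.Nonempty := ⟨0, ∅, by simp, by simp, by simp⟩
  have hbd : BddAbove P := by
    refine ⟨⌈(1 + 2 / ε) ^ Module.finrank ℝ E⌉₊, ?_⟩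
    rintro k ⟨T, h1, h2, rfl⟩
    have := (sepCard T ε hε (fun c hc => hs c (h1 c hc)) h2).trans (Nat.le_ceil _)
    exact_mod_cast this
  obtain ⟨T, h1, h2, h3⟩ := Nat.sSup_mem hne hbd
  refine ⟨T, h1, ?_, sepCard T ε hε (fun c hc => hs c (h1 c hc)) h2⟩
  intro x hx
  by_contra! hcon
  have hxT : x ∉ T := fun h => by
    have := hcon x h
    simp at this
    linarith
  have : (insert x T).card ∈ P := by
    refine ⟨insert x T, ?_, ?_, rfl⟩
    · intro t ht
      rcases Finset.mem_insert.1 ht with rfl | ht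
      · exact hx
      · exact h1 t ht
    · intro c hc d hd hcd
      rcases Finset.mem_insert.1 hc with hc' | hc' <;>
        rcases Finset.mem_insert.1 hd with hd' | hd'
      · exact absurd (hc'.trans hd'.symm) hcd
      · rw [hc']; exact (hcon d hd').le
      · rw [hd', norm_sub_rev]; exact (hcon c hc').le
      · exact h2 c hc' d hd' hcd
  have h4 := le_csSup hbd this
  rw [Finset.card_insert_of_notMem hxT, h3] at h4
  omega

open ProbabilityTheory in
lemma hoeff {X : Type*} [MeasurableSpace X] (D : Measure X) [IsProbabilityMeasure D]
    {m : ℕ} (hm : 0 < m) (g : X → ℝ) (hg : Measurable g) (p c : ℝ) (hc : 0 < c)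
    (hb : ∀ᵐ x ∂D, g x ∈ Set.Icc p (p + 2 * c)) (Λ : ℝ) (hΛ : 0 ≤ Λ) :
    (Measure.pi fun _ : Fin m => D)
      {w : Fin m → X | c * Real.sqrt (2 * Λ / m) ≤ ∫ x, g x ∂D - (1 / (m : ℝ)) * ∑ i, g (w i)}
      ≤ ENNReal.ofReal (Real.exp (-Λ)) := by
  have hm' : (0 : ℝ) < m := by exact_mod_cast hm
  set I := ∫ x, g x ∂D with hI
  have hind : iIndepFun (fun (i : Fin m) (w : Fin m → X) => I - g (w i))
      (Measure.pi fun _ : Fin m => D) :=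
    iIndepFun_pi (X := fun _ x => I - g x) (fun i => (measurable_const.sub hg).aemeasurable)
  have hsub : ∀ i : Fin m, HasSubgaussianMGF (fun (w : Fin m → X) => I - g (w i))
      ((‖(-p) - (-(p + 2 * c))‖₊ / 2) ^ 2) (Measure.pi fun _ : Fin m => D) := by
    intro i
    have hmp := measurePreserving_eval (fun _ : Fin m => D) i
    have h1 := hasSubgaussianMGF_of_mem_Icc (μ := Measure.pi fun _ : Fin m => D)
      (X := fun w : Fin m → X => - g (w i)) (a := -(p + 2 * c)) (b := -p)
      (hg.comp (measurable_pi_apply i)).neg.aemeasurable (by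
        have := hmp.quasiMeasurePreserving.ae hb
        filter_upwards [this] with w hw
        simp only [Function.eval, Set.mem_Icc] at hw ⊢
        constructor <;> linarith [hw.1, hw.2])
    have h2 : ∫ w : Fin m → X, - g (w i) ∂(Measure.pi fun _ : Fin m => D) = - I := by
      have h3 : ∫ y, g y ∂(Measure.map (Function.eval i) (Measure.pi fun _ : Fin m => D))
          = ∫ w : Fin m → X, g (w i) ∂(Measure.pi fun _ : Fin m => D) :=
        integral_map (measurable_pi_apply i).aemeasurable hg.aestronglyMeasurable
      rw [hmp.map_eq] at h3
      rw [integral_neg, hI, h3]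
    rw [h2] at h1
    convert h1 using 2
    ring
  have key := HasSubgaussianMGF.measure_sum_ge_le_of_iIndepFun hind (s := Finset.univ)
    (fun i _ => hsub i) (ε := m * (c * Real.sqrt (2 * Λ / m))) (by positivity)
  rw [← ENNReal.ofReal_toReal (measure_ne_top (Measure.pi fun _ : Fin m => D) _)]
  apply ENNReal.ofReal_le_ofReal
  refine le_trans (le_of_eq ?_) (key.trans (le_of_eq ?_))
  · unfold Measure.real
    congr 2
    ext w
    simp only [Set.mem_ofPred_eq, Finset.sum_sub_distrib, Finset.sum_const, Finset.card_univ,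
      Fintype.card_fin, nsmul_eq_mul]
    have : (m : ℝ) * I - ∑ i, g (w i) = m * (I - (1 / (m : ℝ)) * ∑ i, g (w i)) := by
      field_simp
    rw [this, mul_le_mul_iff_right₀ hm']
  · congr 1
    have e : ‖(-p) - (-(p + 2 * c))‖ = 2 * c := by
      rw [Real.norm_eq_abs, show (-p) - (-(p + 2 * c)) = 2 * c by ring, abs_of_pos (by positivity)]
    push_cast
    simp only [Finset.sum_const, Finset.card_univ, Fintype.card_fin, nsmul_eq_mul, e]
    rw [mul_pow, mul_pow, Real.sq_sqrt (by positivity)]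
    field_simp

lemma sumGeom (M : ℕ) : ∑ k ∈ Finset.range (M + 1), (1 / 2 : ℝ) ^ k * (1 + k) =
    4 - (M + 3) * (1 / 2 : ℝ) ^ M := by
  induction M with
  | zero => norm_num
  | succ M ih =>
    rw [Finset.sum_range_succ, ih]
    push_cast
    ring

noncomputable def incr {X ι : Type*} (f : ι → X → ℝ) (pr : ℕ → ι → ι) : ℕ → ι → X → ℝ
  | 0, t => f t
  | k + 1, t => fun x => f t x - f (pr k t) x

lemma chain {X : Type*} [MeasurableSpace X] (D : Measure X) [IsProbabilityMeasure D]
    {m : ℕ} (hm : 0 < m) {ι : Type*} (f : ι → X → ℝ) (hf : ∀ i, Measurable (f i))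
    (G : X → Prop) (hG : ∀ᵐ x ∂D, G x) (B : ℝ) (hB : 0 < B)
    (hr : ∀ i x, G x → 0 ≤ f i x ∧ f i x ≤ 2 * B)
    (T : ℕ → Finset ι) (pr : ℕ → ι → ι) (hpr : ∀ k i, pr k i ∈ T k)
    (hd : ∀ k i x, G x → |f i x - f (pr k i) x| ≤ B * (1 / 2) ^ (k + 1))
    (V : ℝ) (hV : 0 ≤ V) (hcard : ∀ k, ((T k).card : ℝ) ≤ Real.exp (V * (1 + k)))
    (δ : ℝ) (hδ : 0 < δ) (hδ1 : δ < 1) :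
    ENNReal.ofReal (1 - δ) ≤ (Measure.pi fun _ : Fin m => D)
      {w : Fin m → X | ∀ i, ∫ x, f i x ∂D ≤ (1 / (m : ℝ)) * ∑ j, f i (w j) +
        B * 4 * Real.sqrt (2 * (V + Real.log (2 / δ)) / m)} := by
  have hm' : (0 : ℝ) < m := by exact_mod_cast hm
  set P := Measure.pi fun _ : Fin m => D with hP
  set S := {w : Fin m → X | ∀ i, ∫ x, f i x ∂D ≤ (1 / (m : ℝ)) * ∑ j, f i (w j) +
        B * 4 * Real.sqrt (2 * (V + Real.log (2 / δ)) / m)} with hS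
  have hl2 : Real.log 2 ≤ Real.log (2 / δ) := by
    apply Real.log_le_log (by norm_num)
    rw [le_div_iff₀ hδ]; linarith
  have hl : 0 ≤ Real.log (2 / δ) := le_trans (Real.log_nonneg (by norm_num)) hl2
  set W := V + Real.log (2 / δ) with hW
  have hW0 : 0 ≤ W := by positivity
  have hint : ∀ i, Integrable (f i) D := fun i =>
    Integrable.of_mem_Icc 0 (2 * B) (hf i).aemeasurable (by
      filter_upwards [hG] with x hx using ⟨(hr i x hx).1, (hr i x hx).2⟩)
  let u : ℕ → ℝ := fun k => B * (1 / 2) ^ k * Real.sqrt (2 * ((1 + k) * W) / m)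
  let Z : (X → ℝ) → (Fin m → X) → ℝ := fun g w => ∫ x, g x ∂D - (1 / (m : ℝ)) * ∑ j, g (w j)
  let bad : ℕ → Set (Fin m → X) := fun k => ⋃ t ∈ T k, {w | u k ≤ Z (incr f pr k t) w}
  have hmeas : ∀ k t, Measurable (incr f pr k t) := by
    intro k t
    cases k with
    | zero => exact hf t
    | succ k => exact (hf t).sub (hf _)
  have hbad1 : ∀ k t, P {w | u k ≤ Z (incr f pr k t) w} ≤
      ENNReal.ofReal (Real.exp (-((1 + k) * W))) := by
    intro k t
    cases k with
    | zero =>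
      refine hoeff D hm (incr f pr 0 t) (hmeas 0 t) 0 _ (by positivity) ?_ _ (by positivity)
      filter_upwards [hG] with x hx
      have := hr t x hx
      simpa [incr] using this
    | succ k =>
      refine hoeff D hm (incr f pr (k + 1) t) (hmeas _ t) (-(B * (1 / 2) ^ (k + 1))) _
        (by positivity) ?_ _ (by positivity)
      filter_upwards [hG] with x hx
      have := abs_le.1 (hd k t x hx)
      simp only [incr, Set.mem_Icc]
      constructor <;> linarith [this.1, this.2]
  have hbad2 : ∀ k, P (bad k) ≤ ENNReal.ofReal (δ / 2 / 2 ^ k) := by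
    intro k
    calc P (bad k) ≤ ∑ t ∈ T k, P {w | u k ≤ Z (incr f pr k t) w} := measure_biUnion_finset_le _ _
      _ ≤ ∑ t ∈ T k, ENNReal.ofReal (Real.exp (-((1 + k) * W))) :=
          Finset.sum_le_sum fun t _ => hbad1 k t
      _ = ENNReal.ofReal ((T k).card * Real.exp (-((1 + k) * W))) := by
          rw [Finset.sum_const, nsmul_eq_mul, ENNReal.ofReal_mul (by positivity),
            ENNReal.ofReal_natCast]
      _ ≤ _ := by
          apply ENNReal.ofReal_le_ofReal
          calc (T k).card * Real.exp (-((1 + k) * W))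
              ≤ Real.exp (V * (1 + k)) * Real.exp (-((1 + k) * W)) := by
                gcongr; exact hcard k
            _ = Real.exp (-(Real.log (2 / δ) + k * Real.log (2 / δ))) := by
                rw [← Real.exp_add]; congr 1; rw [hW]; ring
            _ ≤ Real.exp (-(Real.log (2 / δ) + k * Real.log 2)) := by
                gcongr
            _ = _ := by
                rw [neg_add, Real.exp_add, Real.exp_neg, Real.exp_log (by positivity),
                  Real.exp_neg, Real.exp_nat_mul, Real.exp_log (by norm_num)]
                field_simp
  let nb : Set (Fin m → X) := {w | ¬ ∀ j, G (w j)}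
  have hnb : P nb = 0 := by
    have : ∀ᵐ w ∂P, ∀ j, G (w j) := by
      rw [ae_all_iff]
      intro j
      exact (measurePreserving_eval (fun _ : Fin m => D) j).quasiMeasurePreserving.ae hG
    exact ae_iff.1 this
  have hsub : Sᶜ ⊆ nb ∪ ⋃ k, bad k := by
    intro w hw
    by_contra hcon
    simp only [Set.mem_union, not_or, Set.mem_iUnion, not_exists] at hcon
    obtain ⟨hc1, hc2⟩ := hcon
    have hc1 : ∀ j, G (w j) := by
      by_contra h; exact hc1 h
    apply hw
    have hstep : ∀ k, ∀ t ∈ T k, Z (incr f pr k t) w < u k := by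
      intro k t ht
      by_contra! h
      apply hc2 k
      simp only [bad, Set.mem_iUnion]
      exact ⟨t, ht, h⟩
    have hZsub : ∀ i j, Z (fun x => f i x - f j x) w = Z (f i) w - Z (f j) w := by
      intro i j
      simp only [Z]
      rw [integral_sub (hint i) (hint j), Finset.sum_sub_distrib]
      ring
    have hind : ∀ k, ∀ t ∈ T k, Z (f t) w ≤ ∑ j ∈ Finset.range (k + 1), u j := by
      intro k
      induction k with
      | zero =>
        intro t ht
        have := hstep 0 t ht
        simpa [incr] using this.le
      | succ k ih =>
        intro t ht
        have h1 := hstep (k + 1) t ht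
        have h2 := ih (pr k t) (hpr k t)
        simp only [incr, hZsub] at h1
        rw [Finset.sum_range_succ]
        linarith
    set U := Real.sqrt (2 * W / m) with hU
    have hu : ∀ k, u k ≤ B * U * ((1 / 2) ^ k * (1 + k)) := by
      intro k
      have : Real.sqrt (2 * ((1 + k) * W) / m) ≤ (1 + k) * U := by
        rw [show 2 * ((1 + (k : ℝ)) * W) / m = (1 + k) * (2 * W / m) by ring,
          Real.sqrt_mul (by positivity)]
        gcongr
        rw [Real.sqrt_le_left (by positivity)]
        nlinarith [Nat.cast_nonneg (α := ℝ) k]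
      calc u k ≤ B * (1 / 2) ^ k * ((1 + k) * U) := by
            simp only [u]; gcongr
        _ = _ := by ring
    have hsum : ∀ k, ∑ j ∈ Finset.range (k + 1), u j ≤ B * 4 * U := by
      intro k
      calc _ ≤ ∑ j ∈ Finset.range (k + 1), B * U * ((1 / 2) ^ j * (1 + j)) :=
            Finset.sum_le_sum fun j _ => hu j
        _ = B * U * (4 - (k + 3) * (1 / 2 : ℝ) ^ k) := by
            rw [← Finset.mul_sum, sumGeom]
        _ ≤ B * U * 4 := by
            gcongr
            have : (0:ℝ) ≤ (k + 3) * (1 / 2 : ℝ) ^ k := by positivity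
            linarith
        _ = _ := by ring
    intro i
    have hfin : ∀ k : ℕ, Z (f i) w ≤ B * 4 * U + B * (1 / 2) ^ k := by
      intro k
      have h1 := hind k (pr k i) (hpr k i)
      have h2 := hZsub i (pr k i)
      have h3 : Z (fun x => f i x - f (pr k i) x) w ≤ B * (1 / 2) ^ k := by
        simp only [Z]
        have a1 : ∫ x, (f i x - f (pr k i) x) ∂D ≤ B * (1 / 2) ^ (k + 1) := by
          calc _ ≤ ∫ x, B * (1 / 2) ^ (k + 1) ∂D := by
                apply integral_mono_ae ((hint i).sub (hint _)) (integrable_const _)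
                filter_upwards [hG] with x hx
                exact (le_abs_self _).trans (hd k i x hx)
            _ = _ := by simp
        have a2 : -(B * (1 / 2) ^ (k + 1)) ≤
            (1 / (m : ℝ)) * ∑ j, (f i (w j) - f (pr k i) (w j)) := by
          calc -(B * (1 / 2) ^ (k + 1))
              = (1 / (m : ℝ)) * ∑ j : Fin m, (-(B * (1 / 2) ^ (k + 1))) := by
                simp; field_simp
            _ ≤ _ := by
                gcongr with j _
                exact (abs_le.1 (hd k i (w j) (hc1 j))).1
        rw [pow_succ] at a1 a2
        linarith
      have := hsum k
      linarith
    have hlim : Filter.Tendsto (fun k : ℕ => B * 4 * U + B * (1 / 2 : ℝ) ^ k) Filter.atTop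
        (nhds (B * 4 * U + B * 0)) :=
      ((tendsto_pow_atTop_nhds_zero_of_lt_one (by norm_num) (by norm_num)).const_mul B).const_add _
    have hle := ge_of_tendsto' hlim hfin
    simp only [Z] at hle
    linarith
  have hcompl : P Sᶜ ≤ ENNReal.ofReal δ := by
    calc P Sᶜ ≤ P nb + P (⋃ k, bad k) := (measure_mono hsub).trans (measure_union_le _ _)
      _ ≤ 0 + ∑' k, P (bad k) := by
          rw [hnb]; gcongr; exact measure_iUnion_le _
      _ ≤ ∑' k : ℕ, ENNReal.ofReal (δ / 2 / 2 ^ k) := by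
          rw [zero_add]; exact ENNReal.tsum_le_tsum hbad2
      _ = ENNReal.ofReal δ := by
          rw [← ENNReal.ofReal_tsum_of_nonneg (fun k => by positivity) (summable_geometric_two' δ),
            tsum_geometric_two']
  have h1 : (1 : ℝ≥0∞) ≤ P S + ENNReal.ofReal δ := by
    calc (1 : ℝ≥0∞) = P Set.univ := measure_univ.symm
      _ = P (S ∪ Sᶜ) := by rw [Set.union_compl_self]
      _ ≤ P S + P Sᶜ := measure_union_le _ _
      _ ≤ _ := by gcongr
  rw [ENNReal.ofReal_sub _ hδ.le, ENNReal.ofReal_one]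
  exact tsub_le_iff_right.2 h1

section ISTA
open scoped Matrix.Norms.L2Operator

lemma l2_eq {N : ℕ} (x : Fin N → ℝ) : l2 x = ‖WithLp.toLp 2 x‖ := by
  simp [l2, EuclideanSpace.norm_eq]

lemma l2_nonneg {N : ℕ} (x : Fin N → ℝ) : 0 ≤ l2 x := Real.sqrt_nonneg _

lemma l2_zero {N : ℕ} : l2 (0 : Fin N → ℝ) = 0 := by simp [l2]

lemma l2_add {N : ℕ} (x y : Fin N → ℝ) : l2 (x + y) ≤ l2 x + l2 y := by
  simp only [l2_eq, WithLp.toLp_add]; exact norm_add_le _ _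

lemma l2_sub {N : ℕ} (x y : Fin N → ℝ) : l2 (x - y) ≤ l2 x + l2 y := by
  simp only [l2_eq, WithLp.toLp_sub]; exact norm_sub_le _ _

lemma l2_smul {N : ℕ} (c : ℝ) (x : Fin N → ℝ) : l2 (c • x) = |c| * l2 x := by
  simp only [l2_eq, WithLp.toLp_smul, norm_smul, Real.norm_eq_abs]

lemma l2_sq {N : ℕ} (x : Fin N → ℝ) : l2 x ^ 2 = x ⬝ᵥ x := by
  rw [l2, Real.sq_sqrt (Finset.sum_nonneg fun i _ => sq_nonneg _)]
  simp [dotProduct, sq]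

lemma dot_le {N : ℕ} (x y : Fin N → ℝ) : x ⬝ᵥ y ≤ l2 x * l2 y := by
  have := real_inner_le_norm (WithLp.toLp 2 y) (WithLp.toLp 2 x)
  rw [← l2_eq, ← l2_eq, EuclideanSpace.inner_toLp_toLp] at this
  simpa [mul_comm] using this

lemma specNorm_eq {a b : ℕ} (A : Matrix (Fin a) (Fin b) ℝ) : specNorm A = ‖A‖ := by
  rw [Matrix.l2_opNorm_def]; rfl

lemma l2_mulVec {a b : ℕ} (A : Matrix (Fin a) (Fin b) ℝ) (x : Fin b → ℝ) :
    l2 (A *ᵥ x) ≤ ‖A‖ * l2 x := by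
  rw [l2_eq, l2_eq]
  exact Matrix.l2_opNorm_mulVec A (WithLp.toLp 2 x)

lemma l2_transpose {a b : ℕ} (A : Matrix (Fin a) (Fin b) ℝ) : ‖Aᵀ‖ = ‖A‖ := by
  rw [← Matrix.l2_opNorm_conjTranspose A, Matrix.conjTranspose_eq_transpose_of_trivial]

lemma orth_l2 {N : ℕ} {Φ : Matrix (Fin N) (Fin N) ℝ} (h : IsOrthogonal Φ) (x : Fin N → ℝ) :
    l2 (Φ *ᵥ x) = l2 x := by
  have : l2 (Φ *ᵥ x) ^ 2 = l2 x ^ 2 := by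
    rw [l2_sq, l2_sq, Matrix.dotProduct_mulVec, Matrix.vecMul_mulVec, ← Matrix.dotProduct_mulVec]
    have h' : Φᵀ * Φ = 1 := h
    rw [h']
    simp
  exact (sq_eq_sq₀ (l2_nonneg _) (l2_nonneg _)).1 this

lemma orth_T {N : ℕ} {Φ : Matrix (Fin N) (Fin N) ℝ} (h : IsOrthogonal Φ) : IsOrthogonal Φᵀ := by
  have h' : Φᵀ * Φ = 1 := h
  unfold IsOrthogonal
  rw [Matrix.transpose_transpose]
  exact mul_eq_one_comm.1 h'

lemma orth_norm {N : ℕ} {Φ : Matrix (Fin N) (Fin N) ℝ} (h : IsOrthogonal Φ) : ‖Φ‖ ≤ 1 := by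
  rw [Matrix.l2_opNorm_def]
  refine ContinuousLinearMap.opNorm_le_bound _ zero_le_one fun x => ?_
  have := orth_l2 h x.ofLp
  rw [l2_eq, l2_eq] at this
  rw [one_mul]
  exact this.le

lemma soft_eq (mu x : ℝ) (hmu : 0 ≤ mu) : soft mu x = max 0 (x - mu) - max 0 (-x - mu) := by
  unfold soft
  rcases lt_trichotomy x 0 with h | h | h
  · rw [Real.sign_of_neg h, abs_of_neg h, max_eq_left (a := 0) (b := x - mu) (by linarith)]; ring
  · simp [h]
  · rw [Real.sign_of_pos h, abs_of_pos h, max_eq_left (a := 0) (b := -x - mu) (by linarith)]; ring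

lemma soft_lip (mu : ℝ) (hmu : 0 ≤ mu) (x y : ℝ) : |soft mu x - soft mu y| ≤ |x - y| := by
  rw [soft_eq _ _ hmu, soft_eq _ _ hmu]
  rcases max_cases 0 (x - mu) with h1 | h1 <;> rcases max_cases 0 (-x - mu) with h2 | h2 <;>
  rcases max_cases 0 (y - mu) with h3 | h3 <;> rcases max_cases 0 (-y - mu) with h4 | h4 <;>
  rw [h1.1, h2.1, h3.1, h4.1] <;>
  rcases abs_cases (x - y) with h5 | h5 <;> rw [h5.1, abs_le] <;> constructor <;>
  linarith [h1.2, h2.2, h3.2, h4.2, h5.2]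

lemma soft_zero (mu : ℝ) : soft mu 0 = 0 := by simp [soft]

lemma soft_cont (mu : ℝ) (hmu : 0 ≤ mu) : Continuous (soft mu) := by
  have : soft mu = fun x => max 0 (x - mu) - max 0 (-x - mu) := funext fun x => soft_eq mu x hmu
  rw [this]; fun_prop

lemma l2_soft_lip {N : ℕ} (mu : ℝ) (hmu : 0 ≤ mu) (x y : Fin N → ℝ) :
    l2 (soft mu ∘ x - soft mu ∘ y) ≤ l2 (x - y) := by
  unfold l2
  apply Real.sqrt_le_sqrt
  apply Finset.sum_le_sum
  intro i _
  exact sq_le_sq.2 (soft_lip mu hmu (x i) (y i))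

lemma l2_soft {N : ℕ} (mu : ℝ) (hmu : 0 ≤ mu) (x : Fin N → ℝ) : l2 (soft mu ∘ x) ≤ l2 x := by
  have := l2_soft_lip mu hmu x 0
  have h0 : soft mu ∘ (0 : Fin N → ℝ) = 0 := by ext i; simp [soft_zero]
  simpa [h0] using this

lemma sigma_l2 {N : ℕ} (B : ℝ) (hB : 0 < B) (x : Fin N → ℝ) : l2 (sigma B x) ≤ B := by
  unfold sigma
  split_ifs with h
  · exact h
  · have hp : 0 < l2 x := by linarith
    rw [l2_smul, abs_of_pos (by positivity)]
    field_simp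
    exact le_rfl

lemma l2_sub_sq {N : ℕ} (x y : Fin N → ℝ) :
    l2 (x - y) ^ 2 = l2 x ^ 2 + l2 y ^ 2 - 2 * (x ⬝ᵥ y) := by
  rw [l2_sq, l2_sq, l2_sq]
  simp only [sub_dotProduct, dotProduct_sub]
  rw [dotProduct_comm y x]; ring

lemma l2_sub_comm {N : ℕ} (x y : Fin N → ℝ) : l2 (x - y) = l2 (y - x) := by
  rw [l2_eq, l2_eq, WithLp.toLp_sub, WithLp.toLp_sub, norm_sub_rev]

lemma sigma_lip_aux {N : ℕ} (B : ℝ) (hB : 0 < B) (x y : Fin N → ℝ) (hx : l2 x ≤ B)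
    (hy : ¬ l2 y ≤ B) : l2 (x - (B / l2 y) • y) ≤ l2 (x - y) := by
  have hp : 0 < l2 y := by linarith
  apply le_of_sq_le_sq _ (l2_nonneg _)
  rw [l2_sub_sq, l2_sub_sq, l2_smul, abs_of_pos (by positivity), dotProduct_smul, smul_eq_mul,
    div_mul_cancel₀ _ hp.ne']
  have hd := dot_le x y
  set q := l2 y
  set c := x ⬝ᵥ y
  have hc : c ≤ B * q := hd.trans (by gcongr)
  push Not at hy
  have : c * (1 - B / q) ≤ B * q * (1 - B / q) := by
    apply mul_le_mul_of_nonneg_right hc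
    rw [sub_nonneg, div_le_one hp]; exact hy.le
  have e : B * q * (1 - B / q) = B * (q - B) := by field_simp
  nlinarith

lemma sigma_lip {N : ℕ} (B : ℝ) (hB : 0 < B) (x y : Fin N → ℝ) :
    l2 (sigma B x - sigma B y) ≤ l2 (x - y) := by
  unfold sigma
  split_ifs with h1 h2 h2
  · exact le_rfl
  · exact sigma_lip_aux B hB x y h1 h2
  · rw [l2_sub_comm, l2_sub_comm x y]; exact sigma_lip_aux B hB y x h2 h1
  · have hp : 0 < l2 y := by linarith
    have hq : 0 < l2 x := by linarith
    apply le_of_sq_le_sq _ (l2_nonneg _)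
    rw [l2_sub_sq, l2_sub_sq, l2_smul, l2_smul, abs_of_pos (by positivity),
      abs_of_pos (by positivity), dotProduct_smul, smul_dotProduct, smul_eq_mul, smul_eq_mul,
      div_mul_cancel₀ _ hp.ne', div_mul_cancel₀ _ hq.ne']
    have hd := dot_le x y
    set q := l2 y
    set p := l2 x
    set c := x ⬝ᵥ y
    push Not at h1 h2
    have e : B / q * (B / p * c) = B ^ 2 * (c / (p * q)) := by field_simp
    have e2 : c / (p * q) ≤ 1 := by rw [div_le_one (by positivity)]; exact hd
    have e3 : c = p * q * (c / (p * q)) := by field_simp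
    rw [e]
    set r := c / (p * q)
    rw [e3]
    have : B ^ 2 ≤ p * q := by nlinarith
    nlinarith [sq_nonneg (p - q), mul_le_mul_of_nonneg_right this (sub_nonneg.2 e2)]

lemma step_contr {n N : ℕ} (M : Matrix (Fin n) (Fin N) ℝ) (τ : ℝ) (hτ : 0 < τ)
    (hM : τ * ‖M‖ ^ 2 ≤ 1) (v : Fin N → ℝ) : l2 ((1 - τ • (Mᵀ * M)) *ᵥ v) ≤ l2 v := by
  apply le_of_sq_le_sq _ (l2_nonneg _)
  rw [Matrix.sub_mulVec, Matrix.one_mulVec, Matrix.smul_mulVec, l2_sub_sq, l2_smul, abs_of_pos hτ,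
    dotProduct_smul, smul_eq_mul]
  have h1 : v ⬝ᵥ (Mᵀ * M) *ᵥ v = l2 (M *ᵥ v) ^ 2 := by
    rw [l2_sq, Matrix.dotProduct_mulVec (M *ᵥ v), Matrix.vecMul_mulVec,
      ← Matrix.dotProduct_mulVec]
  have h2 : l2 ((Mᵀ * M) *ᵥ v) ≤ ‖M‖ * l2 (M *ᵥ v) := by
    rw [← Matrix.mulVec_mulVec, ← l2_transpose M]; exact l2_mulVec _ _
  have h3 : l2 ((Mᵀ * M) *ᵥ v) ^ 2 ≤ (‖M‖ * l2 (M *ᵥ v)) ^ 2 :=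
    pow_le_pow_left₀ (l2_nonneg _) h2 2
  rw [h1]
  have h4 : τ ^ 2 * l2 ((Mᵀ * M) *ᵥ v) ^ 2 ≤ τ * l2 (M *ᵥ v) ^ 2 := by
    calc _ ≤ τ ^ 2 * (‖M‖ * l2 (M *ᵥ v)) ^ 2 := by gcongr
      _ = (τ * ‖M‖ ^ 2) * (τ * l2 (M *ᵥ v) ^ 2) := by ring
      _ ≤ 1 * (τ * l2 (M *ᵥ v) ^ 2) := by gcongr
      _ = _ := one_mul _
  have h5 : 0 ≤ τ * l2 (M *ᵥ v) ^ 2 := by positivity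
  nlinarith

lemma AΦ_norm {n N : ℕ} (A : Matrix (Fin n) (Fin N) ℝ)
    {Φ : Matrix (Fin N) (Fin N) ℝ} (h : IsOrthogonal Φ) : ‖A * Φ‖ ≤ ‖A‖ :=
  (Matrix.l2_opNorm_mul A Φ).trans
    (mul_le_of_le_one_right (norm_nonneg _) (orth_norm h))

lemma AΦ_contr {n N : ℕ} (A : Matrix (Fin n) (Fin N) ℝ) (τ : ℝ)
    (hτ : 0 < τ)
    (hA : τ * ‖A‖ ^ 2 ≤ 1) {Φ : Matrix (Fin N) (Fin N) ℝ} (h : IsOrthogonal Φ)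
    (v : Fin N → ℝ) : l2 ((1 - τ • (Φᵀ * Aᵀ * A * Φ)) *ᵥ v) ≤ l2 v := by
  have e : Φᵀ * Aᵀ * A * Φ = (A * Φ)ᵀ * (A * Φ) := by
    rw [Matrix.transpose_mul]; simp only [Matrix.mul_assoc]
  rw [e]
  apply step_contr _ _ hτ
  refine le_trans ?_ hA
  gcongr
  exact AΦ_norm A h

/-- `τ‖A‖‖Ax‖ ≤ B`. -/
lemma inp_bound {n N : ℕ} (A : Matrix (Fin n) (Fin N) ℝ) (τ B : ℝ)
    (hτ : 0 < τ)
    (hA : τ * ‖A‖ ^ 2 ≤ 1) (x : Fin N → ℝ) (hx : l2 x ≤ B) :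
    τ * (‖A‖ * l2 (A *ᵥ x)) ≤ B := by
  have hx0 := l2_nonneg x
  calc _ ≤ τ * (‖A‖ * (‖A‖ * l2 x)) := by gcongr; exact l2_mulVec _ _
    _ = (τ * ‖A‖ ^ 2) * l2 x := by ring
    _ ≤ 1 * l2 x := by gcongr
    _ ≤ B := by linarith

lemma ista_bound {n N : ℕ} (A : Matrix (Fin n) (Fin N) ℝ) (τ lam B : ℝ)
    (hτ : 0 < τ)
    (hlam : 0 < lam)
    (hA : τ * ‖A‖ ^ 2 ≤ 1) {Φ : Matrix (Fin N) (Fin N) ℝ} (h : IsOrthogonal Φ)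
    (x : Fin N → ℝ) (hx : l2 x ≤ B) (l : ℕ) :
    l2 (istaVec A τ lam Φ (A *ᵥ x) l) ≤ l * B := by
  induction l with
  | zero => simp [istaVec, l2_zero]
  | succ l ih =>
    rw [istaVec]
    refine (l2_soft _ (by positivity) _).trans ((l2_add _ _).trans ?_)
    have h1 := AΦ_contr A τ hτ hA h (istaVec A τ lam Φ (A *ᵥ x) l)
    have h2 : l2 (τ • ((A * Φ)ᵀ *ᵥ (A *ᵥ x))) ≤ B := by
      rw [l2_smul, abs_of_pos hτ]
      refine le_trans ?_ (inp_bound A τ B hτ hA x hx)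
      gcongr
      refine (l2_mulVec _ _).trans ?_
      rw [l2_transpose]
      gcongr
      · exact l2_nonneg _
      · exact AΦ_norm A h
    push_cast
    linarith

lemma ista_lip {n N : ℕ} (A : Matrix (Fin n) (Fin N) ℝ) (τ lam B : ℝ)
    (hτ : 0 < τ)
    (hlam : 0 < lam)
    (hA : τ * ‖A‖ ^ 2 ≤ 1) {Φ Ψ : Matrix (Fin N) (Fin N) ℝ} (h : IsOrthogonal Φ)
    (h' : IsOrthogonal Ψ) (x : Fin N → ℝ) (hx : l2 x ≤ B) (l : ℕ) :
    l2 (istaVec A τ lam Φ (A *ᵥ x) l - istaVec A τ lam Ψ (A *ᵥ x) l) ≤ l ^ 2 * B * ‖Φ - Ψ‖ := by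
  induction l with
  | zero => simp [istaVec, l2_zero]
  | succ l ih =>
    rw [istaVec, istaVec]
    refine (l2_soft_lip _ (by positivity) _ _).trans ?_
    have hg := ista_bound A τ lam B hτ hlam hA h' x hx l
    set f := istaVec A τ lam Φ (A *ᵥ x) l
    set g := istaVec A τ lam Ψ (A *ᵥ x) l
    have e : (1 - τ • (Φᵀ * Aᵀ * A * Φ)) *ᵥ f + τ • ((A * Φ)ᵀ *ᵥ (A *ᵥ x))
        - ((1 - τ • (Ψᵀ * Aᵀ * A * Ψ)) *ᵥ g + τ • ((A * Ψ)ᵀ *ᵥ (A *ᵥ x)))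
        = (1 - τ • (Φᵀ * Aᵀ * A * Φ)) *ᵥ (f - g)
          + (τ • ((Φ - Ψ)ᵀ *ᵥ (Aᵀ *ᵥ (A *ᵥ x)))
          - (τ • ((Φ - Ψ)ᵀ *ᵥ (Aᵀ *ᵥ (A *ᵥ (Φ *ᵥ g))))
          + τ • (Ψᵀ *ᵥ (Aᵀ *ᵥ (A *ᵥ ((Φ - Ψ) *ᵥ g)))))) := by
      simp only [Matrix.transpose_mul, Matrix.transpose_sub, ← Matrix.mulVec_mulVec,
        Matrix.sub_mulVec, Matrix.one_mulVec, Matrix.mulVec_sub, Matrix.smul_mulVec, smul_sub]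
      abel
    rw [e]
    have hN := norm_nonneg (Φ - Ψ)
    have hAA : ∀ v : Fin N → ℝ, τ * l2 (Aᵀ *ᵥ (A *ᵥ v)) ≤ l2 v := by
      intro v
      have hv := l2_nonneg v
      calc _ ≤ τ * (‖A‖ * (‖A‖ * l2 v)) := by
            gcongr
            refine (l2_mulVec _ _).trans ?_
            rw [l2_transpose]
            gcongr
            exact l2_mulVec _ _
        _ = (τ * ‖A‖ ^ 2) * l2 v := by ring
        _ ≤ 1 * l2 v := by gcongr
        _ = l2 v := one_mul _
    have hT : ∀ v : Fin N → ℝ, l2 ((Φ - Ψ)ᵀ *ᵥ v) ≤ ‖Φ - Ψ‖ * l2 v := by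
      intro v
      rw [← l2_transpose]; exact l2_mulVec _ _
    have b1 := AΦ_contr A τ hτ hA h (f - g)
    have b2 : l2 (τ • ((Φ - Ψ)ᵀ *ᵥ (Aᵀ *ᵥ (A *ᵥ x)))) ≤ ‖Φ - Ψ‖ * B := by
      rw [l2_smul, abs_of_pos hτ]
      calc _ ≤ τ * (‖Φ - Ψ‖ * l2 (Aᵀ *ᵥ (A *ᵥ x))) := by gcongr; exact hT _
        _ = ‖Φ - Ψ‖ * (τ * l2 (Aᵀ *ᵥ (A *ᵥ x))) := by ring
        _ ≤ ‖Φ - Ψ‖ * B := by gcongr; exact (hAA x).trans hx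
    have b3 : l2 (τ • ((Φ - Ψ)ᵀ *ᵥ (Aᵀ *ᵥ (A *ᵥ (Φ *ᵥ g))))) ≤ ‖Φ - Ψ‖ * (l * B) := by
      rw [l2_smul, abs_of_pos hτ]
      calc _ ≤ τ * (‖Φ - Ψ‖ * l2 (Aᵀ *ᵥ (A *ᵥ (Φ *ᵥ g)))) := by gcongr; exact hT _
        _ = ‖Φ - Ψ‖ * (τ * l2 (Aᵀ *ᵥ (A *ᵥ (Φ *ᵥ g)))) := by ring
        _ ≤ ‖Φ - Ψ‖ * (l * B) := by
            refine mul_le_mul_of_nonneg_left ((hAA _).trans ?_) hN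
            rw [orth_l2 h]; exact hg
    have b4 : l2 (τ • (Ψᵀ *ᵥ (Aᵀ *ᵥ (A *ᵥ ((Φ - Ψ) *ᵥ g))))) ≤ ‖Φ - Ψ‖ * (l * B) := by
      rw [l2_smul, abs_of_pos hτ, orth_l2 (orth_T h')]
      refine (hAA _).trans ((l2_mulVec _ _).trans ?_)
      gcongr
    refine (l2_add _ _).trans ?_
    have c1 := l2_sub (τ • ((Φ - Ψ)ᵀ *ᵥ (Aᵀ *ᵥ (A *ᵥ x))))
      (τ • ((Φ - Ψ)ᵀ *ᵥ (Aᵀ *ᵥ (A *ᵥ (Φ *ᵥ g))))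
          + τ • (Ψᵀ *ᵥ (Aᵀ *ᵥ (A *ᵥ ((Φ - Ψ) *ᵥ g)))))
    have c2 := l2_add (τ • ((Φ - Ψ)ᵀ *ᵥ (Aᵀ *ᵥ (A *ᵥ (Φ *ᵥ g)))))
          (τ • (Ψᵀ *ᵥ (Aᵀ *ᵥ (A *ᵥ ((Φ - Ψ) *ᵥ g)))))
    push_cast
    nlinarith

lemma loss_lip {n N : ℕ} (A : Matrix (Fin n) (Fin N) ℝ) (τ lam B : ℝ)
    (hτ : 0 < τ)
    (hlam : 0 < lam)
    (hB : 0 < B)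
    (hA : τ * ‖A‖ ^ 2 ≤ 1) {Φ Ψ : Matrix (Fin N) (Fin N) ℝ} (h : IsOrthogonal Φ)
    (h' : IsOrthogonal Ψ) (x : Fin N → ℝ) (hx : l2 x ≤ B) (L : ℕ) :
    |l2 (sigma B (Φ *ᵥ istaVec A τ lam Φ (A *ᵥ x) L) - x)
      - l2 (sigma B (Ψ *ᵥ istaVec A τ lam Ψ (A *ᵥ x) L) - x)| ≤ B * ((L + 1) ^ 2 * ‖Φ - Ψ‖) := by
  have hg := ista_bound A τ lam B hτ hlam hA h' x hx L
  have hl := ista_lip A τ lam B hτ hlam hA h h' x hx L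
  set f := istaVec A τ lam Φ (A *ᵥ x) L
  set g := istaVec A τ lam Ψ (A *ᵥ x) L
  have hN := norm_nonneg (Φ - Ψ)
  have h1 : l2 (Φ *ᵥ f - Ψ *ᵥ g) ≤ B * ((L + 1) ^ 2 * ‖Φ - Ψ‖) := by
    have e : Φ *ᵥ f - Ψ *ᵥ g = Φ *ᵥ (f - g) + (Φ - Ψ) *ᵥ g := by
      rw [Matrix.mulVec_sub, Matrix.sub_mulVec]; abel
    rw [e]
    refine (l2_add _ _).trans ?_
    rw [orth_l2 h]
    have b : l2 ((Φ - Ψ) *ᵥ g) ≤ ‖Φ - Ψ‖ * (L * B) := (l2_mulVec _ _).trans (by gcongr)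
    have : 0 ≤ (L + 1 : ℝ) * (B * ‖Φ - Ψ‖) := by positivity
    nlinarith
  refine le_trans ?_ ((sigma_lip B hB _ _).trans h1)
  have := abs_norm_sub_norm_le (WithLp.toLp 2 (sigma B (Φ *ᵥ f) - x))
    (WithLp.toLp 2 (sigma B (Ψ *ᵥ g) - x))
  rw [← WithLp.toLp_sub, ← l2_eq, ← l2_eq, ← l2_eq, sub_sub_sub_cancel_right] at this
  exact this

lemma l2_cont {N : ℕ} : Continuous (l2 : (Fin N → ℝ) → ℝ) := by
  unfold l2; fun_prop

lemma sigma_meas {N : ℕ} (B : ℝ) : Measurable (sigma B : (Fin N → ℝ) → (Fin N → ℝ)) := by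
  unfold sigma
  refine Measurable.ite ?_ measurable_id ?_
  · exact measurableSet_le l2_cont.measurable measurable_const
  · exact (measurable_const.div l2_cont.measurable).smul measurable_id

lemma ista_cont {n N : ℕ} (A : Matrix (Fin n) (Fin N) ℝ) (τ lam : ℝ)
    (hτ : 0 < τ)
    (hlam : 0 < lam)
    (Φ : Matrix (Fin N) (Fin N) ℝ) (l : ℕ) :
    Continuous fun x : Fin N → ℝ => istaVec A τ lam Φ (A *ᵥ x) l := by
  induction l with
  | zero => simp only [istaVec]; exact continuous_const
  | succ l ih =>
    simp only [istaVec]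
    apply continuous_pi
    intro i
    refine (soft_cont _ (by positivity)).comp ((continuous_apply i).comp ?_)
    exact (continuous_const.matrix_mulVec ih).add
      ((continuous_const.matrix_mulVec (continuous_const.matrix_mulVec continuous_id)).const_smul τ)

lemma loss_meas {n N : ℕ} (A : Matrix (Fin n) (Fin N) ℝ) (τ lam B : ℝ)
    (hτ : 0 < τ)
    (hlam : 0 < lam)
    (Φ : Matrix (Fin N) (Fin N) ℝ) (L : ℕ) :
    Measurable fun x => l2 (sigma B (Φ *ᵥ istaVec A τ lam Φ (A *ᵥ x) L) - x) := by
  refine l2_cont.measurable.comp (((sigma_meas B).comp ?_).sub measurable_id)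
  exact (continuous_const.matrix_mulVec (ista_cont A τ lam hτ hlam Φ L)).measurable

lemma netCard (L k : ℕ) :
    1 + 2 / ((1 / 2 : ℝ) ^ (k + 1) / (L + 1) ^ 2) ≤
      Real.exp (2 * Real.log (Real.exp 1 + 8 * Real.exp 1 * L) * (1 + k)) := by
  have he : (2.7 : ℝ) ≤ Real.exp 1 := by linarith [Real.exp_one_gt_d9]
  have hL : (0 : ℝ) ≤ L := Nat.cast_nonneg _
  set s := Real.exp 1 + 8 * Real.exp 1 * (L : ℝ) with hs
  have hs1 : 2.7 * (L + 1) ≤ s := by rw [hs]; nlinarith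
  have hs0 : 0 < s := by positivity
  have e : Real.exp (2 * Real.log s * (1 + k)) = (s ^ 2) ^ (k + 1) := by
    rw [← pow_mul, ← Real.exp_log (pow_pos hs0 (2 * (k + 1))), Real.log_pow]
    congr 1; push_cast; ring
  rw [e]
  have h7 : 7 * (L + 1 : ℝ) ^ 2 ≤ s ^ 2 := by nlinarith
  have h2 : (2 : ℝ) ≤ s ^ 2 := by nlinarith
  calc 1 + 2 / ((1 / 2 : ℝ) ^ (k + 1) / (L + 1) ^ 2)
        = 1 + (2 : ℝ) ^ k * (4 * ((L : ℝ) + 1) ^ 2) := by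
        rw [one_div, inv_pow, pow_succ]; field_simp; ring
    _ ≤ (2 : ℝ) ^ k * (7 * ((L : ℝ) + 1) ^ 2) := by
        have : (1 : ℝ) ≤ 2 ^ k := one_le_pow₀ (by norm_num)
        have h1 : (1 : ℝ) ≤ (L + 1) ^ 2 := one_le_pow₀ (by linarith)
        nlinarith
    _ ≤ (s ^ 2) ^ k * s ^ 2 := by gcongr
    _ = _ := (pow_succ _ _).symm

lemma main_aux {n N : ℕ} (A : Matrix (Fin n) (Fin N) ℝ) (τ lam B : ℝ)
    (hτ : 0 < τ)
    (hlam : 0 < lam)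
    (hB : 0 < B)
    {m : ℕ} (hm : 0 < m) (L : ℕ) (hA : τ * ‖A‖ ^ 2 ≤ 1)
    (D : Measure (Fin N → ℝ)) [IsProbabilityMeasure D]
    (hbdd : ∀ᵐ x ∂D, l2 x ≤ B)
    (δ : ℝ) (hδ : 0 < δ) (hδ1 : δ < 1) :
    ENNReal.ofReal (1 - δ) ≤
      (Measure.pi fun _ : Fin m => D)
        {X : Fin m → Fin N → ℝ |
          ∀ i : {Φ : Matrix (Fin N) (Fin N) ℝ // IsOrthogonal Φ},
            (∫ x, l2 (sigma B (i.1 *ᵥ istaVec A τ lam i.1 (A *ᵥ x) L) - x) ∂D) ≤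
              (1 / (m : ℝ)) * ∑ j, l2 (sigma B (i.1 *ᵥ istaVec A τ lam i.1 (A *ᵥ X j) L) - X j)
              + B * 4 * Real.sqrt (2 * (((N * N : ℕ) : ℝ) *
                (2 * Real.log (Real.exp 1 + 8 * Real.exp 1 * L)) + Real.log (2 / δ)) / m)} := by
  classical
  have hnet := fun k : ℕ => exNet {Φ : Matrix (Fin N) (Fin N) ℝ | IsOrthogonal Φ}
    (fun c hc => orth_norm hc) ((1 / 2 : ℝ) ^ (k + 1) / (L + 1) ^ 2) (by positivity)
  choose T hT1 hT2 hT3 using hnet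
  have hpr : ∀ (k : ℕ) (i : {Φ : Matrix (Fin N) (Fin N) ℝ // IsOrthogonal Φ}),
      ∃ j : {Φ : Matrix (Fin N) (Fin N) ℝ // IsOrthogonal Φ}, j.1 ∈ T k ∧
        ‖i.1 - j.1‖ ≤ (1 / 2 : ℝ) ^ (k + 1) / (L + 1) ^ 2 := by
    intro k i
    obtain ⟨t, ht, ht2⟩ := hT2 k i.1 i.2
    exact ⟨⟨t, hT1 k t ht⟩, ht, ht2⟩
  choose pr hpr1 hpr2 using hpr
  have hlog : 0 ≤ Real.log (Real.exp 1 + 8 * Real.exp 1 * (L : ℝ)) := by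
    apply Real.log_nonneg
    have : 1 ≤ Real.exp 1 := Real.one_le_exp (by norm_num)
    have : 0 ≤ 8 * Real.exp 1 * (L : ℝ) := by positivity
    linarith
  refine chain D hm (fun (i : {Φ : Matrix (Fin N) (Fin N) ℝ // IsOrthogonal Φ}) x =>
      l2 (sigma B (i.1 *ᵥ istaVec A τ lam i.1 (A *ᵥ x) L) - x))
    (fun i => loss_meas A τ lam B hτ hlam i.1 L) (fun x => l2 x ≤ B) hbdd B hB ?_
    (fun k => (T k).subtype IsOrthogonal) pr ?_ ?_ _ (by positivity) ?_ δ hδ hδ1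
  · intro i x hx
    refine ⟨l2_nonneg _, (l2_sub _ _).trans ?_⟩
    have := sigma_l2 B hB (i.1 *ᵥ istaVec A τ lam i.1 (A *ᵥ x) L)
    linarith
  · intro k i
    rw [Finset.mem_subtype]; exact hpr1 k i
  · intro k i x hx
    refine (loss_lip A τ lam B hτ hlam hB hA i.2 (pr k i).2 x hx L).trans ?_
    have := hpr2 k i
    rw [le_div_iff₀ (by positivity)] at this
    gcongr
    linarith
  · intro k
    have h1 : (((T k).subtype IsOrthogonal).card : ℝ) ≤ (T k).card := by
      rw [Finset.card_subtype]
      exact_mod_cast Finset.card_filter_le _ _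
    have h2 : Module.finrank ℝ (Matrix (Fin N) (Fin N) ℝ) = N * N := by
      rw [Module.finrank_matrix]; simp
    have h3 := hT3 k
    rw [h2] at h3
    refine h1.trans (h3.trans ?_)
    refine (pow_le_pow_left₀ (by positivity) (netCard L k) _).trans (le_of_eq ?_)
    rw [← Real.exp_nat_mul]
    congr 1; ring

end ISTA

lemma sqrtAdd (x y : ℝ) (hx : 0 ≤ x) (hy : 0 ≤ y) :
    Real.sqrt (x + y) ≤ Real.sqrt x + Real.sqrt y := by
  rw [Real.sqrt_le_left (by positivity), add_sq, Real.sq_sqrt hx, Real.sq_sqrt hy]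
  nlinarith [mul_nonneg (Real.sqrt_nonneg x) (Real.sqrt_nonneg y)]

theorem statement0 {n N m : ℕ} (hm : 0 < m) (A : Matrix (Fin n) (Fin N) ℝ)
    (τ lam : ℝ) (hτ : 0 < τ) (hlam : 0 < lam) (L : ℕ)
    (Bout : ℝ) (hBout : 0 < Bout)
    (hA : τ * specNorm A ^ 2 ≤ 1)
    (D : Measure (Fin N → ℝ)) [IsProbabilityMeasure D]
    (hbdd : ∀ᵐ x ∂D, l2 x ≤ Bout)
    (δ : ℝ) (hδ : 0 < δ) (hδ1 : δ < 1) :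
    ENNReal.ofReal (1 - δ) ≤
      (Measure.pi fun _ : Fin m => D)
        {X : Fin m → Fin N → ℝ |
          ∀ Φ : Matrix (Fin N) (Fin N) ℝ, IsOrthogonal Φ →
            (∫ x, l2 (sigma Bout (Φ *ᵥ istaVec A τ lam Φ (A *ᵥ x) L) - x) ∂D) ≤
              (1 / (m : ℝ)) * ∑ i, l2 (sigma Bout (Φ *ᵥ istaVec A τ lam Φ (A *ᵥ X i) L) - X i)
              + 8 * Bout * Real.sqrt ((N : ℝ) * (n : ℝ) *
                  Real.log (2 + 8 * (L : ℝ) * ((L : ℝ) + 3)) / (m : ℝ))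
              + 8 * Bout * (N : ℝ) *
                  Real.sqrt (Real.log (Real.exp 1 + 8 * Real.exp 1 * (L : ℝ))) / Real.sqrt (m : ℝ)
              + Bout * Real.sqrt (128 * Real.log (4 / δ) / (m : ℝ))} := by
  refine (main_aux A τ lam Bout hτ hlam hBout hm L (by rw [← specNorm_eq]; exact hA) D hbdd
    δ hδ hδ1).trans (measure_mono ?_)
  intro X hX Φ hΦ
  refine (hX ⟨Φ, hΦ⟩).trans ?_
  have hm' : (0 : ℝ) < m := by exact_mod_cast hm
  set a := Real.log (Real.exp 1 + 8 * Real.exp 1 * (L : ℝ)) with ha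
  have ha0 : 0 ≤ a := by
    apply Real.log_nonneg
    have : 1 ≤ Real.exp 1 := Real.one_le_exp (by norm_num)
    have : 0 ≤ 8 * Real.exp 1 * (L : ℝ) := by positivity
    linarith
  have hl : 0 ≤ Real.log (2 / δ) := by
    apply Real.log_nonneg
    rw [le_div_iff₀ hδ]; linarith
  have hl4 : Real.log (2 / δ) ≤ Real.log (4 / δ) := by
    apply Real.log_le_log (by positivity)
    gcongr; norm_num
  have k1 : Real.sqrt (2 * (((N * N : ℕ) : ℝ) * (2 * a) + Real.log (2 / δ)) / m) ≤
      2 * (N * Real.sqrt a / Real.sqrt m) + Real.sqrt (2 * Real.log (2 / δ) / m) := by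
    rw [show 2 * (((N * N : ℕ) : ℝ) * (2 * a) + Real.log (2 / δ)) / m
      = (2 * N) ^ 2 * (a / m) + 2 * Real.log (2 / δ) / m by push_cast; ring]
    refine (sqrtAdd _ _ (by positivity) (by positivity)).trans (le_of_eq ?_)
    rw [Real.sqrt_mul (by positivity), Real.sqrt_sq (by positivity), Real.sqrt_div ha0]
    ring
  have k2 : 4 * Real.sqrt (2 * Real.log (2 / δ) / m) ≤ Real.sqrt (128 * Real.log (4 / δ) / m) := by
    apply Real.le_sqrt_of_sq_le
    rw [mul_pow, Real.sq_sqrt (by positivity)]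
    rw [show (4:ℝ) ^ 2 * (2 * Real.log (2 / δ) / m) = 32 * Real.log (2 / δ) / m by ring]
    gcongr
    linarith
  have k3 : 0 ≤ 8 * Bout * Real.sqrt ((N : ℝ) * (n : ℝ) *
                  Real.log (2 + 8 * (L : ℝ) * ((L : ℝ) + 3)) / (m : ℝ)) := by positivity
  have k4 := mul_le_mul_of_nonneg_left k1 (show 0 ≤ Bout * 4 by positivity)
  have k5 := mul_le_mul_of_nonneg_left k2 hBout.le
  have e : 8 * Bout * (N : ℝ) * Real.sqrt a / Real.sqrt (m : ℝ)
    = Bout * 4 * (2 * (N * Real.sqrt a / Real.sqrt m)) := by ring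
  rw [e]
  simp only at k4 ⊢
  nlinarith [k3, k4, k5]
end

section
/- For any measurement matrix A ∈ ℝ^{n×N}, any orthogonal matrix Φ ∈ O(N), any l ∈ ℕ, any τ, λ > 0, and any Y ∈ ℝ^{n×m}, the output of the unfolded ISTA network after l layers satisfies ‖f_Φ^l(Y)‖_F ≤ τ‖A‖_{2→2}·‖Y‖_F · Σ_{k=0}^{l−1} ‖I − τAᵀA‖_{2→2}^k. -/
open MeasureTheory Matrix
open scoped ENNReal

theorem frob_sq {a b : ℕ} (M : Matrix (Fin a) (Fin b) ℝ) :
    frobNorm M = Real.sqrt (Matrix.trace (Mᵀ * M)) := by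
  unfold frobNorm
  congr 1
  rw [Finset.sum_comm]
  simp [Matrix.trace, Matrix.mul_apply, sq]

theorem frob_orth {a b : ℕ} (U : Matrix (Fin a) (Fin a) ℝ) (hU : Uᵀ * U = 1)
    (M : Matrix (Fin a) (Fin b) ℝ) : frobNorm (U * M) = frobNorm M := by
  rw [frob_sq, frob_sq, Matrix.transpose_mul, Matrix.mul_assoc, ← Matrix.mul_assoc Uᵀ, hU,
    Matrix.one_mul]

section
attribute [local instance] Matrix.frobeniusNormedAddCommGroup Matrix.frobeniusNormedSpace

theorem frob_eq {a b : ℕ} (M : Matrix (Fin a) (Fin b) ℝ) : frobNorm M = ‖M‖ := by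
  rw [Matrix.frobenius_norm_def, frobNorm, Real.sqrt_eq_rpow]
  simp

theorem frob_add {a b : ℕ} (M K : Matrix (Fin a) (Fin b) ℝ) :
    frobNorm (M + K) ≤ frobNorm M + frobNorm K := by
  simp only [frob_eq]
  exact norm_add_le _ _

theorem frob_smul {a b : ℕ} (t : ℝ) (ht : 0 < t) (M : Matrix (Fin a) (Fin b) ℝ) :
    frobNorm (t • M) = t * frobNorm M := by
  simp only [frob_eq]
  rw [norm_smul, Real.norm_of_nonneg ht.le]
end

theorem spec_nonneg {a b : ℕ} (M : Matrix (Fin a) (Fin b) ℝ) : 0 ≤ specNorm M := norm_nonneg _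

section
open scoped Matrix.Norms.L2Operator

theorem spec_transpose {a b : ℕ} (M : Matrix (Fin a) (Fin b) ℝ) :
    specNorm Mᵀ = specNorm M := by
  have := Matrix.l2_opNorm_conjTranspose M
  rw [Matrix.conjTranspose_eq_transpose_of_trivial] at this
  exact this
end

theorem frob_mul {a b c : ℕ} (B : Matrix (Fin a) (Fin b) ℝ) (M : Matrix (Fin b) (Fin c) ℝ) :
    frobNorm (B * M) ≤ specNorm B * frobNorm M := by
  unfold frobNorm
  apply Real.sqrt_le_iff.2
  refine ⟨mul_nonneg (spec_nonneg _) (Real.sqrt_nonneg _), ?_⟩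
  rw [mul_pow, Real.sq_sqrt (by positivity), Finset.sum_comm, Finset.sum_comm (s := Finset.univ (α := Fin b)),
    Finset.mul_sum]
  refine Finset.sum_le_sum fun j _ => ?_
  have h := (LinearMap.toContinuousLinearMap (Matrix.toEuclideanLin B)).le_opNorm
    (WithLp.toLp 2 (fun k => M k j))
  have h2 := pow_le_pow_left₀ (norm_nonneg _) h 2
  rw [mul_pow, EuclideanSpace.norm_sq_eq, EuclideanSpace.norm_sq_eq] at h2
  simpa [specNorm, Matrix.mul_apply, Matrix.mulVec, dotProduct] using h2

theorem soft_sq (mu x : ℝ) (h : 0 ≤ mu) : soft mu x ^ 2 ≤ x ^ 2 := by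
  rw [sq_le_sq, soft, abs_mul]
  have h1 : |Real.sign x| ≤ 1 := by
    rcases Real.sign_apply_eq x with h | h | h <;> simp [h]
  have h2 : |max 0 (|x| - mu)| ≤ |x| := by
    rw [abs_of_nonneg (le_max_left _ _)]
    exact max_le (abs_nonneg _) (by linarith)
  calc _ ≤ 1 * |x| := mul_le_mul h1 h2 (abs_nonneg _) zero_le_one
    _ = _ := one_mul _

theorem frob_soft {a b : ℕ} (mu : ℝ) (h : 0 ≤ mu) (M : Matrix (Fin a) (Fin b) ℝ) :
    frobNorm (softMat mu M) ≤ frobNorm M := by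
  unfold frobNorm
  exact Real.sqrt_le_sqrt (Finset.sum_le_sum fun i _ => Finset.sum_le_sum fun j _ =>
    soft_sq mu (M i j) h)

theorem statement2 {n N m : ℕ} (A : Matrix (Fin n) (Fin N) ℝ)
    (Φ : Matrix (Fin N) (Fin N) ℝ) (hΦ : IsOrthogonal Φ)
    (l : ℕ) (τ lam : ℝ) (hτ : 0 < τ) (hlam : 0 < lam)
    (Y : Matrix (Fin n) (Fin m) ℝ) :
    frobNorm (ista A τ lam Φ Y l) ≤
      τ * specNorm A * frobNorm Y *
        ∑ k ∈ Finset.range l, specNorm (1 - τ • (Aᵀ * A)) ^ k := by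
  have hΦ' : Φᵀ * Φ = 1 := hΦ
  have hT : Φᵀᵀ * Φᵀ = 1 := by
    rw [Matrix.transpose_transpose]
    exact mul_eq_one_comm.1 hΦ'
  induction l with
  | zero => simp [ista, frobNorm]
  | succ l ih =>
    rw [ista]
    refine (frob_soft _ (by positivity) _).trans ((frob_add _ _).trans ?_)
    have e1 : (1 - τ • (Φᵀ * Aᵀ * A * Φ)) * ista A τ lam Φ Y l
        = Φᵀ * ((1 - τ • (Aᵀ * A)) * (Φ * ista A τ lam Φ Y l)) := by
      have : (1 - τ • (Φᵀ * Aᵀ * A * Φ)) = Φᵀ * (1 - τ • (Aᵀ * A)) * Φ := by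
        rw [Matrix.mul_sub, Matrix.sub_mul, Matrix.mul_one, hΦ']
        simp [Matrix.mul_assoc]
      rw [this]
      simp only [Matrix.mul_assoc]
    rw [e1, frob_orth _ hT, frob_smul _ hτ, Matrix.transpose_mul, Matrix.mul_assoc,
      frob_orth _ hT]
    have h1 := frob_mul (1 - τ • (Aᵀ * A)) (Φ * ista A τ lam Φ Y l)
    rw [frob_orth _ hΦ'] at h1
    have h2 := frob_mul Aᵀ Y
    rw [spec_transpose] at h2
    have h3 := mul_le_mul_of_nonneg_left ih (spec_nonneg (1 - τ • (Aᵀ * A)))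
    have h4 := mul_le_mul_of_nonneg_left h2 hτ.le
    rw [Finset.sum_range_succ']
    simp only [pow_succ, ← Finset.sum_mul, pow_zero]
    linarith
end
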